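/- Goodman–Pollack–Wenger theorem (as a consequence of the main theorem with the free matroid on k+2 copies): Let F be a finite family of convex sets in ℝ^d and 0 ≤ k < d. Suppose there is a map φ : F → ℝ^k such that for all disjoint subfamilies G₁, G₂ ⊆ F: conv G₁ ∩ conv G₂ = ∅ implies conv φ(G₁) ∩ conv φ(G₂) = ∅. Then F has a hyperplane transversal. -/

import Mathlib

open RealInnerProductSpace


namespace GPW
open Finsupp

abbrev Ch (V : Type*) := List V →₀ ZMod 2

noncomputable section

def cone {V : Type*} (a : V) : Ch V →ₗ[ZMod 2] Ch V := Finsupp.lmapDomain _ _ (List.cons a)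

def bdL {V : Type*} : List V → Ch V
  | [] => 0
  | a :: l => single l 1 + cone a (bdL l)

def bd {V : Type*} : Ch V →ₗ[ZMod 2] Ch V := Finsupp.linearCombination (ZMod 2) bdL

def nu {V : Type*} [Neg V] : Ch V →ₗ[ZMod 2] Ch V :=
  Finsupp.lmapDomain _ _ (List.map (fun x => -x))

@[simp] lemma cone_single {V : Type*} (a : V) (l : List V) (z : ZMod 2) :
    cone a (single l z) = single (a :: l) z := by simp [cone, Finsupp.mapDomain_single]

@[simp] lemma nu_single {V : Type*} [Neg V] (l : List V) (z : ZMod 2) :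
    nu (single l z) = single (l.map (fun x => -x)) z := by
  simp [nu, Finsupp.mapDomain_single]

@[simp] lemma bd_single {V : Type*} (l : List V) : bd (single l 1) = bdL l := by
  simp [bd]

lemma ext_single {V W : Type*} [AddCommGroup W] [Module (ZMod 2) W]
    {f g : Ch V →ₗ[ZMod 2] W} (h : ∀ l, f (single l 1) = g (single l 1)) : f = g := by
  apply Finsupp.lhom_ext'
  intro l
  apply LinearMap.ext_ring
  exact h l

lemma bd_cone {V : Type*} (a : V) (c : Ch V) : bd (cone a c) = c + cone a (bd c) := by
  have : (bd ∘ₗ cone a : Ch V →ₗ[ZMod 2] Ch V) = LinearMap.id + cone a ∘ₗ bd := by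
    apply ext_single
    intro l
    simp [bdL]
  exact LinearMap.congr_fun this c

lemma bd_bd {V : Type*} (c : Ch V) : bd (bd c) = 0 := by
  have : (bd ∘ₗ bd : Ch V →ₗ[ZMod 2] Ch V) = 0 := by
    apply ext_single
    intro l
    simp only [LinearMap.comp_apply, bd_single, LinearMap.zero_apply]
    induction l with
    | nil => simp [bdL]
    | cons a l ih =>
      simp only [bdL, map_add, bd_single, bd_cone, ih, map_zero, add_zero]
      exact ZModModule.add_self _
  exact LinearMap.congr_fun this c

lemma nu_cone {V : Type*} [Neg V] (a : V) (c : Ch V) : nu (cone a c) = cone (-a) (nu c) := by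
  have : (nu ∘ₗ cone a : Ch V →ₗ[ZMod 2] Ch V) = cone (-a) ∘ₗ nu := by
    apply ext_single
    intro l
    simp
  exact LinearMap.congr_fun this c

lemma nu_bd {V : Type*} [Neg V] (c : Ch V) : nu (bd c) = bd (nu c) := by
  have : (nu ∘ₗ bd : Ch V →ₗ[ZMod 2] Ch V) = bd ∘ₗ nu := by
    apply ext_single
    intro l
    simp only [LinearMap.comp_apply, bd_single, nu_single]
    induction l with
    | nil => simp [bdL]
    | cons a l ih => simp [bdL, nu_cone, ih]
  exact LinearMap.congr_fun this c

lemma nu_nu {V : Type*} [InvolutiveNeg V] (c : Ch V) : nu (nu c) = c := by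
  have : (nu ∘ₗ nu : Ch V →ₗ[ZMod 2] Ch V) = LinearMap.id := by
    apply ext_single
    intro l
    simp
  exact LinearMap.congr_fun this c

/-- chains supported on lists satisfying `P` -/
abbrev sup {V : Type*} (P : List V → Prop) : Submodule (ZMod 2) (Ch V) :=
  Finsupp.supported (ZMod 2) (ZMod 2) {l | P l}

lemma single_mem {V : Type*} {P : List V → Prop} {l : List V} (h : P l) :
    (single l 1 : Ch V) ∈ sup P := Finsupp.single_mem_supported _ _ h

lemma map_mem {V W : Type*} [AddCommGroup W] [Module (ZMod 2) W] (f : Ch V →ₗ[ZMod 2] W)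
    (N : Submodule (ZMod 2) W) {P : List V → Prop}
    (h : ∀ l, P l → f (single l 1) ∈ N) {c : Ch V} (hc : c ∈ sup P) : f c ∈ N := by
  rw [sup, Finsupp.supported_eq_span_single] at hc
  induction hc using Submodule.span_induction with
  | mem x hx => obtain ⟨l, hl, rfl⟩ := hx; exact h l hl
  | zero => simp
  | add x y _ _ hx hy => rw [map_add]; exact N.add_mem hx hy
  | smul a x _ hx => rw [map_smul]; exact N.smul_mem a hx

lemma map_eq {V W : Type*} [AddCommGroup W] [Module (ZMod 2) W] (f g : Ch V →ₗ[ZMod 2] W)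
    {P : List V → Prop}
    (h : ∀ l, P l → f (single l 1) = g (single l 1)) {c : Ch V} (hc : c ∈ sup P) :
    f c = g c := by
  have := map_mem (f - g) ⊥ (P := P) (fun l hl => by simp [h l hl]) hc
  simpa [sub_eq_zero] using this

lemma sup_mono {V : Type*} {P Q : List V → Prop} (h : ∀ l, P l → Q l) {c : Ch V}
    (hc : c ∈ sup P) : c ∈ sup Q :=
  Finsupp.supported_mono (fun l hl => h l hl) hc

lemma bdL_mem {V : Type*} (l : List V) :
    bdL l ∈ sup (fun l' => l'.length + 1 = l.length ∧ ∀ x ∈ l', x ∈ l) := by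
  induction l with
  | nil => simp [bdL]
  | cons a l ih =>
    rw [bdL]
    refine Submodule.add_mem _ (single_mem ⟨rfl, fun x hx => List.mem_cons_of_mem _ hx⟩) ?_
    refine map_mem (cone a) _ ?_ ih
    rintro l' ⟨h1, h2⟩
    rw [cone_single]
    apply single_mem
    refine ⟨by simp [← h1], ?_⟩
    intro x hx
    rcases List.mem_cons.1 hx with rfl | hx
    · simp
    · exact List.mem_cons_of_mem _ (h2 x hx)

section sd
variable {E : Type*} [NormedAddCommGroup E] [NormedSpace ℝ E]

def bary (l : List E) : E := (l.length : ℝ)⁻¹ • l.sum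

def sd : ℕ → (Ch E →ₗ[ZMod 2] Ch E)
  | 0 => LinearMap.id
  | n + 1 => Finsupp.linearCombination (ZMod 2) (fun l => cone (bary l) (sd n (bdL l)))

lemma sd_single (n : ℕ) (l : List E) :
    sd (n+1) (single l 1) = cone (bary l) (sd n (bdL l)) := by simp [sd]

lemma bary_neg (l : List E) : bary (l.map (fun x => -x)) = - bary l := by
  have : (l.map (fun x => -x)).sum = - l.sum := by
    induction l with
    | nil => simp
    | cons a l ih => simp only [List.map_cons, List.sum_cons, ih]; abel
  simp [bary, this]

lemma nu_sd (n : ℕ) (c : Ch E) : nu (sd n c) = sd n (nu c) := by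
  induction n generalizing c with
  | zero => simp [sd]
  | succ n ih =>
    have : (nu ∘ₗ sd (n+1) : Ch E →ₗ[ZMod 2] Ch E) = sd (n+1) ∘ₗ nu := by
      apply ext_single
      intro l
      simp only [LinearMap.comp_apply, nu_single, sd_single, nu_cone, ih, bary_neg]
      rw [← bd_single, nu_bd, nu_single, bd_single]
    exact LinearMap.congr_fun this c

lemma bd_sd (n : ℕ) {c : Ch E} (hc : c ∈ sup (fun l => l.length = n + 1)) :
    bd (sd (n+1) c) = sd n (bd c) := by
  induction n generalizing c with
  | zero =>
    have key : ∀ l : List E, l.length = 0 + 1 → ((bd : Ch E →ₗ[ZMod 2] Ch E) ∘ₗ sd (0+1)) (single l 1) =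
        ((sd 0 : Ch E →ₗ[ZMod 2] Ch E) ∘ₗ bd) (single l 1) := ?_
    · exact map_eq _ _ key hc
    intro l hl
    obtain ⟨a, rfl⟩ := List.length_eq_one_iff.1 hl
    simp only [LinearMap.comp_apply, sd_single, bd_cone]
    simp [bdL, sd]
  | succ n ih =>
    have key : ∀ l : List E, l.length = n + 1 + 1 →
        ((bd : Ch E →ₗ[ZMod 2] Ch E) ∘ₗ sd (n+1+1)) (single l 1) =
        ((sd (n+1) : Ch E →ₗ[ZMod 2] Ch E) ∘ₗ bd) (single l 1) := ?_
    · exact map_eq _ _ key hc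
    intro l hl
    simp only [LinearMap.comp_apply, sd_single, bd_cone]
    rw [ih (c := bdL l) (sup_mono (fun l' h => by omega) (bdL_mem l)), ← bd_single, bd_bd]
    simp

lemma bary_dist {d : ℕ} {r : ℝ} (l : List E) (hd : l.length ≤ d)
    (hr : ∀ x ∈ l, ∀ y ∈ l, dist x y ≤ r) (x : E) (hx : x ∈ l) :
    dist (bary l) x ≤ (1 - (d:ℝ)⁻¹) * r := by
  classical
  have hp := List.perm_cons_erase hx
  have hr0 : 0 ≤ r := by simpa using hr x hx x hx
  have hlen : l.length = (l.erase x).length + 1 := by simpa using hp.length_eq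
  set l' := l.erase x
  have hsub : ∀ y ∈ l', ‖y - x‖ ≤ r := fun y hy => by
    rw [← dist_eq_norm]; exact hr y (List.mem_of_mem_erase hy) x hx
  have key : ∀ m : List E, (∀ y ∈ m, ‖y - x‖ ≤ r) →
      ‖m.sum - (m.length : ℝ) • x‖ ≤ m.length * r := by
    intro m hm
    induction m with
    | nil => simp
    | cons a m ih =>
      have h1 := ih (fun y hy => hm y (List.mem_cons_of_mem _ hy))
      have h2 := hm a (by simp)
      have : (a :: m).sum - ((a :: m).length : ℝ) • x =
          (a - x) + (m.sum - (m.length : ℝ) • x) := by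
        simp [add_smul]; abel
      rw [this]
      refine (norm_add_le _ _).trans ?_
      simp only [List.length_cons, Nat.cast_add, Nat.cast_one]
      linarith
  have hn : (0:ℝ) < l.length := by rw [hlen]; positivity
  have e : bary l - x = (l.length : ℝ)⁻¹ • (l'.sum - (l'.length : ℝ) • x) := by
    have hs : l.sum = x + l'.sum := by rw [hp.sum_eq]; simp [l']
    have h2 : x = (l.length : ℝ)⁻¹ • ((l.length : ℝ) • x) := by
      rw [smul_smul, inv_mul_cancel₀ hn.ne', one_smul]
    rw [bary, hs]
    nth_rw 2 [h2]
    rw [← smul_sub]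
    congr 1
    rw [hlen]; push_cast; rw [add_smul, one_smul]; abel
  rw [dist_eq_norm, e, norm_smul, norm_inv, Real.norm_natCast]
  have h3 := key l' hsub
  have hl'' : (l'.length : ℝ) = l.length - 1 := by rw [hlen]; push_cast; ring
  calc (l.length : ℝ)⁻¹ * ‖l'.sum - (l'.length : ℝ) • x‖
      ≤ (l.length : ℝ)⁻¹ * (l'.length * r) := by gcongr
    _ = (1 - (l.length:ℝ)⁻¹) * r := by rw [hl'']; field_simp
    _ ≤ (1 - (d:ℝ)⁻¹) * r := by gcongr

lemma bary_mem (l : List E) (hl : l ≠ []) : bary l ∈ convexHull ℝ {x | x ∈ l} := by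
  have hn : (l.length : ℝ) ≠ 0 := by simpa using hl
  have h := (convex_convexHull ℝ {x | x ∈ l}).sum_mem (t := (Finset.univ : Finset (Fin l.length)))
    (w := fun _ => (l.length : ℝ)⁻¹) (z := fun i => l[i]) (fun _ _ => by positivity)
    (by simp [hn]) (fun i _ => subset_convexHull ℝ _ (by simp))
  rw [← Finset.smul_sum] at h
  have e : ∑ i : Fin l.length, l[i] = l.sum := by simp
  rwa [e] at h

lemma sd_mem {d : ℕ} {r : ℝ} (n : ℕ) (hn : n ≤ d) (l : List E) (hl : l.length = n)
    (hr : ∀ x ∈ l, ∀ y ∈ l, dist x y ≤ r) :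
    sd n (single l 1) ∈ sup (fun l' => l'.length = n ∧
      (∀ x ∈ l', x ∈ convexHull ℝ {x | x ∈ l}) ∧
      (∀ x ∈ l', ∀ y ∈ l', dist x y ≤ (1 - (d:ℝ)⁻¹) * r)) := by
  induction n generalizing l with
  | zero =>
    obtain rfl := List.length_eq_zero_iff.1 hl
    exact single_mem (by simp)
  | succ n ih =>
    have hne : l ≠ [] := by rintro rfl; simp at hl
    rw [sd_single]
    have h1 : sd n (bdL l) ∈ sup (fun l' => l'.length = n ∧
      (∀ x ∈ l', x ∈ convexHull ℝ {x | x ∈ l}) ∧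
      (∀ x ∈ l', ∀ y ∈ l', dist x y ≤ (1 - (d:ℝ)⁻¹) * r)) := by
      refine map_mem (sd n) _ ?_ (bdL_mem l)
      rintro l' ⟨h1, h2⟩
      refine sup_mono ?_ (ih (by omega) l' (by omega)
        (fun x hx y hy => hr x (h2 x hx) y (h2 y hy)))
      rintro l'' ⟨h3, h4, h5⟩
      exact ⟨h3, fun x hx => convexHull_mono (fun z hz => h2 z hz) (h4 x hx), h5⟩
    refine map_mem (cone (bary l)) _ ?_ h1
    rintro l' ⟨h3, h4, h5⟩
    rw [cone_single]
    apply single_mem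
    have hball : ∀ x ∈ l', dist (bary l) x ≤ (1 - (d:ℝ)⁻¹) * r := by
      intro x hx
      have : convexHull ℝ {x | x ∈ l} ⊆ Metric.closedBall (bary l) ((1 - (d:ℝ)⁻¹) * r) := by
        apply convexHull_min _ (convex_closedBall _ _)
        intro y hy
        rw [Metric.mem_closedBall, dist_comm]
        exact bary_dist l (by omega) hr y hy
      have := this (h4 x hx)
      rwa [Metric.mem_closedBall, dist_comm] at this
    refine ⟨by simp [h3], ?_, ?_⟩
    · intro x hx
      rcases List.mem_cons.1 hx with rfl | hx
      · exact bary_mem l hne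
      · exact h4 x hx
    · intro x hx y hy
      rcases List.mem_cons.1 hx with rfl | hx
      · rcases List.mem_cons.1 hy with rfl | hy
        · rw [dist_self]
          obtain ⟨z, hz⟩ := List.exists_mem_of_ne_nil l hne
          exact dist_nonneg.trans (bary_dist (d := d) l (by omega) hr z hz)
        · exact hball y hy
      · rcases List.mem_cons.1 hy with rfl | hy
        · rw [dist_comm]; exact hball x hx
        · exact h5 x hx y hy

end sd

section fan

def flip (p : ℕ × Bool) : ℕ × Bool := (p.1, !p.2)

def wt (m : ℕ) (P : Multiset (ℕ × Bool)) (t : ℕ) : ZMod 2 :=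
  if P = 0 then 1 else if P = {(m, true)} then (if Even t then 1 else 0)
  else if P = {(m, false)} then (if Even t then 0 else 1) else 0

def al : ℕ → Multiset (ℕ × Bool) → ZMod 2
  | 0, S => if S = 0 then 1 else 0
  | m + 1, S => wt m (S.filter (fun p => p.1 = m)) (S.filter (fun p => ¬ p.1 = m)).card *
      al m (S.filter (fun p => ¬ p.1 = m))

lemma al_card (m : ℕ) (S : Multiset (ℕ × Bool)) (h : al m S ≠ 0) : S.card ≤ m := by
  induction m generalizing S with
  | zero =>
    simp only [al] at h
    by_cases hS : S = 0
    · simp [hS]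
    · simp [hS] at h
  | succ m ih =>
    simp only [al] at h
    have h1 := ih _ (right_ne_zero_of_mul h)
    have h2 := left_ne_zero_of_mul h
    have h3 : (S.filter (fun p => p.1 = m)).card ≤ 1 := by
      unfold wt at h2
      split_ifs at h2 with a b c d e
      all_goals first | (exact absurd rfl h2) | simp [*]
    have h4 := Multiset.filter_add_not (fun p : ℕ × Bool => p.1 = m) S
    have h5 := congrArg Multiset.card h4
    rw [Multiset.card_add] at h5
    omega

lemma al_zero (m : ℕ) : al m 0 = 1 := by
  induction m with
  | zero => simp [al]
  | succ m ih => simp [al, wt, ih]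

def w1 (c : ℕ) (b : Bool) (t : ℕ) : ZMod 2 :=
  if c = 0 then 1 else if c = 1 then (if (b = true ↔ Even t) then 1 else 0) else 0

lemma al_rep (m c : ℕ) (b : Bool) (T : Multiset (ℕ × Bool)) (hT : ∀ p ∈ T, p.1 < m) :
    al (m+1) (Multiset.replicate c (m, b) + T) = w1 c b T.card * al m T := by
  have h1 : (Multiset.replicate c (m, b) + T).filter (fun p => p.1 = m) =
      Multiset.replicate c (m, b) := by
    rw [Multiset.filter_add, Multiset.filter_eq_self.2, Multiset.filter_eq_nil.2, add_zero]
    · intro p hp; exact (hT p hp).ne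
    · intro p hp; rw [Multiset.eq_of_mem_replicate hp]
  have h2 : (Multiset.replicate c (m, b) + T).filter (fun p => ¬ p.1 = m) = T := by
    have h3 : T.filter (fun p => ¬ p.1 = m) = T :=
      Multiset.filter_eq_self.2 (fun p hp => (hT p hp).ne)
    rw [Multiset.filter_add, h3, Multiset.filter_eq_nil.2, zero_add]
    intro p hp; rw [Multiset.eq_of_mem_replicate hp]; simp
  simp only [al, h1, h2]
  congr 1
  unfold wt w1
  rcases c with _ | _ | c
  · simp
  · cases b <;> by_cases h : Even T.card <;> simp [h]
  · have h3 : ∀ x : ℕ × Bool, Multiset.replicate (c+1+1) (m, b) ≠ {x} := by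
      intro x hx
      have := congrArg Multiset.card hx
      simp at this
    have h4 : Multiset.replicate (c+1+1) (m, b) ≠ 0 := by
      intro hx
      have := congrArg Multiset.card hx
      simp at this
    rw [if_neg h4, if_neg (h3 _), if_neg (h3 _)]
    simp

lemma al_fan (m : ℕ) (S : Multiset (ℕ × Bool)) (hS : ∀ p ∈ S, p.1 < m)
    (hc : ∀ p ∈ S, ∀ q ∈ S, q ≠ flip p) :
    (S.map (fun y => al m (S.erase y))).sum = al m S + al m (S.map flip) := by
  induction m generalizing S with
  | zero =>
    have : S = 0 := Multiset.eq_zero_of_forall_notMem (fun p hp => by simpa using hS p hp)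
    subst this
    simp only [Multiset.map_zero, Multiset.sum_zero]
    exact (ZModModule.add_self _).symm
  | succ m ih =>
    obtain ⟨b, c, T, hT, rfl⟩ : ∃ b c T, (∀ p ∈ T, p.1 < m) ∧
        S = Multiset.replicate c (m, b) + T := by
      have h4 := Multiset.filter_add_not (fun p : ℕ × Bool => p.1 = m) S
      have : ∃ b, ∀ p ∈ S.filter (fun p => p.1 = m), p = (m, b) := by
        by_cases h : (m, true) ∈ S
        · refine ⟨true, ?_⟩
          intro p hp
          obtain ⟨hp1, hp2⟩ := Multiset.mem_filter.1 hp
          obtain ⟨p1, p2⟩ := p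
          simp only at hp2
          subst hp2
          cases p2
          · exact absurd rfl (hc _ h _ hp1)
          · rfl
        · refine ⟨false, ?_⟩
          intro p hp
          obtain ⟨hp1, hp2⟩ := Multiset.mem_filter.1 hp
          obtain ⟨p1, p2⟩ := p
          simp only at hp2
          subst hp2
          cases p2
          · rfl
          · exact absurd hp1 h
      obtain ⟨b, hb⟩ := this
      refine ⟨b, (S.filter (fun p => p.1 = m)).card, S.filter (fun p => ¬ p.1 = m), ?_, ?_⟩
      · intro p hp
        obtain ⟨hp1, hp2⟩ := Multiset.mem_filter.1 hp
        have := hS p hp1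
        omega
      · rw [← Multiset.eq_replicate_card.2 hb, h4]
    have hIH := ih T hT (fun p hp q hq => hc p (by simp [hp]) q (by simp [hq]))
    have hflip : (Multiset.replicate c (m, b) + T).map flip =
        Multiset.replicate c (m, !b) + T.map flip := by
      simp [flip]
    have hTf : ∀ p ∈ T.map flip, p.1 < m := by
      intro p hp
      obtain ⟨q, hq, rfl⟩ := Multiset.mem_map.1 hp
      exact hT q hq
    rw [hflip, al_rep m c b T hT, al_rep m c (!b) _ hTf, Multiset.map_add, Multiset.sum_add]
    have hsum2 : (T.map (fun y => al (m+1) ((Multiset.replicate c (m, b) + T).erase y))).sum =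
        w1 c b (T.card - 1) * (al m T + al m (T.map flip)) := by
      rw [← hIH, ← Multiset.sum_map_mul_left]
      congr 1
      apply Multiset.map_congr rfl
      intro y hy
      rw [Multiset.erase_add_right_pos _ hy, al_rep m c b (T.erase y)
        (fun p hp => hT p (Multiset.mem_of_mem_erase hp)), Multiset.card_erase_of_mem hy]
      rfl
    have hsum1 : ((Multiset.replicate c (m, b)).map
        (fun y => al (m+1) ((Multiset.replicate c (m, b) + T).erase y))).sum =
        (c : ZMod 2) * (w1 (c - 1) b T.card * al m T) := by
      rw [Multiset.map_replicate, Multiset.sum_replicate, nsmul_eq_mul]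
      rcases c with _ | c
      · simp
      · rw [Multiset.replicate_succ, Multiset.cons_add, Multiset.erase_cons_head,
          al_rep m c b T hT]
        simp
    rw [hsum1, hsum2, Multiset.card_map]
    have h2 : (2 : ZMod 2) = 0 := rfl
    rcases c with _ | _ | c
    · simp [w1]
    · rcases Nat.eq_zero_or_pos T.card with h0 | h0
      · have : T = 0 := Multiset.card_eq_zero.1 h0
        subst this
        cases b <;> simp [w1, al_zero] <;> exact ZModModule.add_self _
      · obtain ⟨t, ht⟩ : ∃ t, T.card = t + 1 := ⟨T.card - 1, by omega⟩
        rw [ht]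
        have e : ∀ x : ZMod 2, x + x = 0 := fun x => ZModModule.add_self x
        cases b <;> by_cases h : Even t <;>
          simp [w1, h, Nat.even_add_one, ← add_assoc, e]
    · rcases c with _ | c
      · have : ((0 + 1 + 1 : ℕ) : ZMod 2) = 0 := rfl
        rw [this]
        simp [w1]
      · simp [w1]

open Classical in
lemma lin_bdL {V : Type*} (g : Multiset V → ZMod 2) (L : List V) :
    Finsupp.linearCombination (ZMod 2) (fun L : List V => g L) (bdL L) =
      ((L : Multiset V).map (fun y => g ((L : Multiset V).erase y))).sum := by
  induction L generalizing g with
  | nil => simp [bdL]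
  | cons a L ih =>
    have h1 : Finsupp.linearCombination (ZMod 2) (fun L : List V => g L) (cone a (bdL L)) =
        Finsupp.linearCombination (ZMod 2) (fun L : List V => g (a ::ₘ (L : Multiset V)))
          (bdL L) := by
      rw [cone, Finsupp.lmapDomain_apply, Finsupp.linearCombination_mapDomain]
      rfl
    rw [bdL, map_add, h1, ih (fun M => g (a ::ₘ M)), ← Multiset.cons_coe, Multiset.map_cons,
      Multiset.sum_cons]
    congr 1
    · simp
    · congr 1
      apply Multiset.map_congr rfl
      intro y hy
      by_cases h : y = a
      · subst h
        rw [Multiset.erase_cons_head, Multiset.cons_erase hy]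
      · rw [Multiset.erase_cons_tail _ (Ne.symm h)]

lemma tucker {V : Type*} [Neg V] (l : V → ℕ × Bool) {k d : ℕ} (hkd : k < d)
    (h s : ℕ → Ch V) (s0 : s 0 = single [] 1) (hs : ∀ n, s (n+1) = h n + nu (h n))
    (hb : ∀ n < d, bd (h n) = s n)
    (hP : ∀ n < d, h n ∈ sup (fun L => L.length = n + 1 ∧
      ∀ x ∈ L, (l x).1 < k ∧ l (-x) = flip (l x) ∧ ∀ y ∈ L, l y ≠ flip (l x))) : False := by
  classical
  let F : Ch V →ₗ[ZMod 2] ZMod 2 :=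
    Finsupp.linearCombination (ZMod 2) (fun L : List V => al k ((L : Multiset V).map l))
  have hF : ∀ L : List V, F (single L 1) = al k ((L : Multiset V).map l) := by
    intro L; simp [F]
  have step : ∀ n < d, F (s n) = F (s (n+1)) := by
    intro n hn
    rw [hs, ← hb n hn]
    have key : ∀ L : List V, (L.length = n + 1 ∧
      ∀ x ∈ L, (l x).1 < k ∧ l (-x) = flip (l x) ∧ ∀ y ∈ L, l y ≠ flip (l x)) →
      (F ∘ₗ bd) (single L 1) = (F ∘ₗ (LinearMap.id + nu)) (single L 1) := by
      rintro L ⟨-, hL⟩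
      simp only [LinearMap.comp_apply, bd_single, LinearMap.add_apply, LinearMap.id_apply,
        map_add, nu_single, hF]
      have h1 := lin_bdL (fun M => al k (M.map l)) L
      have h2 := al_fan k ((L : Multiset V).map l)
        (by intro p hp
            obtain ⟨x, hx, rfl⟩ := Multiset.mem_map.1 hp
            exact (hL x hx).1)
        (by intro p hp q hq
            obtain ⟨x, hx, rfl⟩ := Multiset.mem_map.1 hp
            obtain ⟨y, hy, rfl⟩ := Multiset.mem_map.1 hq
            exact (hL x hx).2.2 y hy)
      have h3 : (((L.map (fun x => -x) : List V) : Multiset V).map l) =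
          ((L : Multiset V).map l).map flip := by
        rw [← Multiset.map_coe, Multiset.map_map, Multiset.map_map]
        apply Multiset.map_congr rfl
        intro x hx
        exact (hL x hx).2.1
      rw [h3, ← h2]
      refine h1.trans ?_
      rw [Multiset.map_map]
      congr 1
      apply Multiset.map_congr rfl
      intro y hy
      simp only [Function.comp]
      rw [Multiset.map_erase_of_mem _ _ hy]
    exact (map_eq _ _ key (hP n hn)).trans (by simp)
  have h0 : F (s 0) = 1 := by rw [s0, hF]; simp [al_zero]
  have hall : ∀ n ≤ d, F (s n) = 1 := by
    intro n hn
    induction n with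
    | zero => exact h0
    | succ n ih => rw [← step n (by omega)]; exact ih (by omega)
  obtain ⟨n, rfl⟩ : ∃ n, d = n + 1 := ⟨d - 1, by omega⟩
  have hz : ∀ L : List V, L.length = n + 1 → F (single L 1) = 0 := by
    intro L hL
    rw [hF]
    by_contra hne
    have := al_card _ _ hne
    simp at this
    omega
  have h1 := map_eq (F ∘ₗ (LinearMap.id + nu)) 0 (P := fun L => L.length = n + 1)
    (fun L hL => by
      simp only [LinearMap.comp_apply, LinearMap.add_apply, LinearMap.id_apply, map_add,
        nu_single]
      rw [hz L hL, hz _ (by simpa using hL)]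
      simp)
    (sup_mono (fun L hL => hL.1) (hP n (by omega)))
  have h2 := hall (n+1) le_rfl
  rw [hs] at h2
  have h3 : F (h n + nu (h n)) = 0 := by simpa using h1
  rw [h3] at h2
  exact absurd h2 (by decide)

end fan

section sys
variable {E : Type*} [NormedAddCommGroup E] [InnerProductSpace ℝ E]

def oct (e : ℕ → E) : ℕ → Ch E
  | 0 => single [] 1
  | n + 1 => cone (e n) (oct e n) + nu (cone (e n) (oct e n))

lemma nu_oct (e : ℕ → E) (n : ℕ) : nu (oct e n) = oct e n := by
  cases n with
  | zero => simp [oct]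
  | succ n => rw [oct, map_add, nu_nu, add_comm]

lemma bd_oct (e : ℕ → E) (n : ℕ) : bd (oct e n) = 0 := by
  induction n with
  | zero => simp [oct, bdL]
  | succ n ih =>
    rw [oct, map_add, ← nu_bd, bd_cone, ih, map_zero, add_zero, nu_oct]
    exact ZModModule.add_self _

def OP (e : ℕ → E) (d n : ℕ) (L : List E) : Prop :=
  L.length = n ∧ ∃ u : E, ‖u‖ ≤ n ∧ (∀ j, n ≤ j → j < d → ⟪u, e j⟫ = 0) ∧
    ∀ x ∈ L, ⟪u, x⟫ = 1 ∧ ‖x‖ ≤ 1 ∧ ∀ j, n ≤ j → j < d → ⟪e j, x⟫ = 0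

lemma cone_oct_mem (e : ℕ → E) (d : ℕ)
    (he : ∀ i < d, ∀ j < d, ⟪e i, e j⟫ = if i = j then (1:ℝ) else 0) (n : ℕ) (hn : n < d)
    (hc : oct e n ∈ sup (OP e d n)) : cone (e n) (oct e n) ∈ sup (OP e d (n+1)) := by
  have hnorm : ‖e n‖ = 1 := by
    have h1 := he n hn n hn
    rw [real_inner_self_eq_norm_sq, if_pos rfl] at h1
    nlinarith [norm_nonneg (e n)]
  refine map_mem (cone (e n)) _ ?_ hc
  rintro L ⟨hL, u, hu1, hu2, hx⟩
  rw [cone_single]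
  apply single_mem
  refine ⟨by simp [hL], u + e n, ?_, ?_, ?_⟩
  · refine (norm_add_le _ _).trans ?_
    rw [hnorm]; push_cast; linarith
  · intro j hj hjd
    rw [inner_add_left, hu2 j (by omega) hjd, he n hn j hjd, if_neg (by omega), add_zero]
  · intro x hxm
    rcases List.mem_cons.1 hxm with rfl | hxm
    · refine ⟨?_, hnorm.le, ?_⟩
      · rw [inner_add_left, hu2 n le_rfl hn, he n hn n hn, if_pos rfl, zero_add]
      · intro j hj hjd
        rw [he j hjd n hn, if_neg (by omega)]
    · obtain ⟨h1, h2, h3⟩ := hx x hxm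
      refine ⟨?_, h2, fun j hj hjd => h3 j (by omega) hjd⟩
      rw [inner_add_left, h1, h3 n le_rfl hn, add_zero]

lemma oct_mem (e : ℕ → E) (d : ℕ)
    (he : ∀ i < d, ∀ j < d, ⟪e i, e j⟫ = if i = j then (1:ℝ) else 0) (n : ℕ) (hn : n ≤ d) :
    oct e n ∈ sup (OP e d n) := by
  induction n with
  | zero => exact single_mem ⟨rfl, 0, by simp, by simp, by simp⟩
  | succ n ih =>
    have h1 := cone_oct_mem e d he n (by omega) (ih (by omega))
    rw [oct]
    refine Submodule.add_mem _ h1 (map_mem nu _ ?_ h1)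
    rintro L ⟨hL, u, hu1, hu2, hx⟩
    rw [nu_single]
    apply single_mem
    refine ⟨by simp [hL], -u, by simpa using hu1, ?_, ?_⟩
    · intro j hj hjd; rw [inner_neg_left, hu2 j hj hjd, neg_zero]
    · intro x hxm
      obtain ⟨y, hy, rfl⟩ := List.mem_map.1 hxm
      obtain ⟨h1, h2, h3⟩ := hx y hy
      refine ⟨by simpa using h1, by simpa using h2, ?_⟩
      intro j hj hjd; rw [inner_neg_right, h3 j hj hjd, neg_zero]

def Q (d : ℕ) (r : ℝ) (n : ℕ) (L : List E) : Prop :=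
  L.length = n ∧ (∃ u : E, ‖u‖ ≤ d ∧ ∀ x ∈ L, ⟪u, x⟫ = 1 ∧ ‖x‖ ≤ 1) ∧
    ∀ x ∈ L, ∀ y ∈ L, dist x y ≤ r

lemma exists_sys (e : ℕ → E) (d : ℕ)
    (he : ∀ i < d, ∀ j < d, ⟪e i, e j⟫ = if i = j then (1:ℝ) else 0) (N : ℕ) :
    ∃ h s : ℕ → Ch E, s 0 = single [] 1 ∧ (∀ n, s (n+1) = h n + nu (h n)) ∧
      (∀ n < d, bd (h n) = s n) ∧
      ∀ n < d, h n ∈ sup (Q d ((1 - (d:ℝ)⁻¹) ^ N * 2) (n+1)) := by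
  induction N with
  | zero =>
    refine ⟨fun n => cone (e n) (oct e n), oct e, rfl, fun n => rfl, ?_, ?_⟩
    · intro n hn
      rw [bd_cone, bd_oct, map_zero, add_zero]
    · intro n hn
      refine sup_mono ?_ (cone_oct_mem e d he n hn (oct_mem e d he n hn.le))
      rintro L ⟨hL, u, hu1, hu2, hx⟩
      refine ⟨hL, ⟨u, hu1.trans (by exact_mod_cast hn), fun x hxm => ⟨(hx x hxm).1, (hx x hxm).2.1⟩⟩, ?_⟩
      intro x hxm y hym
      rw [dist_eq_norm]
      have := norm_sub_le x y
      have h1 := (hx x hxm).2.1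
      have h2 := (hx y hym).2.1
      simp only [pow_zero, one_mul]
      linarith
  | succ N ih =>
    obtain ⟨h, s, h0, h1, h2, h3⟩ := ih
    refine ⟨fun n => sd (n+1) (h n), fun n => sd n (s n), ?_, ?_, ?_, ?_⟩
    · simp [h0, sd]
    · intro n; simp only [h1, map_add, nu_sd]
    · intro n hn
      simp only
      rw [bd_sd n (sup_mono (fun L hL => hL.1) (h3 n hn)), h2 n hn]
    · intro n hn
      refine map_mem (sd (n+1)) _ ?_ (h3 n hn)
      rintro L ⟨hL, ⟨u, hu, hx⟩, hr⟩
      refine sup_mono ?_ (sd_mem (d := d) (n+1) hn L hL hr)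
      rintro L' ⟨h4, h5, h6⟩
      refine ⟨h4, ⟨u, hu, ?_⟩, ?_⟩
      · have hsub : convexHull ℝ {x | x ∈ L} ⊆ {x | ⟪u, x⟫ = 1} ∩ Metric.closedBall 0 1 := by
          apply convexHull_min
          · intro x hxm
            obtain ⟨h7, h8⟩ := hx x hxm
            exact ⟨h7, by simpa using h8⟩
          · refine Convex.inter ?_ (convex_closedBall _ _)
            exact convex_hyperplane (f := fun x : E => ⟪u, x⟫)
              ⟨fun x y => inner_add_right _ _ _, fun c x => by simp [inner_smul_right]⟩ 1
        intro x hxm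
        obtain ⟨h7, h8⟩ := hsub (h5 x hxm)
        exact ⟨h7, by simpa using h8⟩
      · intro x hxm y hym
        refine (h6 x hxm y hym).trans (le_of_eq ?_)
        ring

end sys

/-- The Borsuk-Ulam theorem -/
theorem borsuk_ulam {d k : ℕ} (hkd : k < d)
    (f : EuclideanSpace ℝ (Fin d) → Fin k → ℝ) (hf : ContinuousOn f {0}ᶜ)
    (hodd : ∀ x, f (-x) = - f x) : ∃ x, x ≠ 0 ∧ f x = 0 := by
  classical
  by_contra hno
  push Not at hno
  have hd : (0:ℝ) < d := by exact_mod_cast (by omega : 0 < d)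
  let K : Set (EuclideanSpace ℝ (Fin d)) := Metric.closedBall 0 1 ∩ {x | (d:ℝ)⁻¹ ≤ ‖x‖}
  have hK : IsCompact K := (isCompact_closedBall _ _).inter_right
    (isClosed_le continuous_const continuous_norm)
  have hK0 : K ⊆ {0}ᶜ := by
    rintro x ⟨-, hx⟩ rfl
    have : (0:ℝ) < (d:ℝ)⁻¹ := by positivity
    simp at hx
    omega
  have hfK : ContinuousOn f K := hf.mono hK0
  obtain ⟨c, hc, hcK⟩ : ∃ c > 0, ∀ x ∈ K, c ≤ ‖f x‖ := by
    rcases K.eq_empty_or_nonempty with h | h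
    · exact ⟨1, one_pos, by simp [h]⟩
    · obtain ⟨x, hx, hmin⟩ := hK.exists_isMinOn h hfK.norm
      exact ⟨‖f x‖, norm_pos_iff.2 (hno x (hK0 hx)), fun y hy => hmin hy⟩
  have huc := hK.uniformContinuousOn_of_continuous hfK
  rw [Metric.uniformContinuousOn_iff] at huc
  obtain ⟨δ, hδ, huc⟩ := huc c hc
  obtain ⟨N, hN⟩ : ∃ N : ℕ, (1 - (d:ℝ)⁻¹) ^ N * 2 < δ := by
    have hlt : 1 - (d:ℝ)⁻¹ < 1 := by
      have : (0:ℝ) < (d:ℝ)⁻¹ := by positivity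
      linarith
    obtain ⟨N, hN⟩ := exists_pow_lt_of_lt_one (half_pos hδ) hlt
    exact ⟨N, by linarith⟩
  -- labels
  have hidx : ∀ v : Fin k → ℝ, v ≠ 0 → ∃ i, |v i| = ‖v‖ := by
    intro v hv
    have : Nonempty (Fin k) := by
      by_contra hemp
      rw [not_nonempty_iff] at hemp
      exact hv (Subsingleton.elim _ _)
    obtain ⟨i, hi⟩ := Finite.exists_max (fun i => |v i|)
    refine ⟨i, le_antisymm (by simpa using norm_le_pi_norm v i) ?_⟩
    exact (pi_norm_le_iff_of_nonneg (abs_nonneg _)).2 hi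
  let ix : (Fin k → ℝ) → ℕ := fun a =>
    if h : ∃ i, a i = ‖a‖ then (Classical.choose h : Fin k) else 0
  let l : EuclideanSpace ℝ (Fin d) → ℕ × Bool := fun x =>
    (ix (fun i => |f x i|), decide (∃ i : Fin k, (i : ℕ) = ix (fun i => |f x i|) ∧ 0 < f x i))
  have hix : ∀ x, x ≠ 0 → ∃ i : Fin k, (i : ℕ) = ix (fun i => |f x i|) ∧ |f x i| = ‖f x‖ := by
    intro x hx
    have hnn : ‖(fun i => |f x i|)‖ = ‖f x‖ := by
      simp [Pi.norm_def]
    have h : ∃ i, (fun i => |f x i|) i = ‖(fun i => |f x i|)‖ := by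
      rw [hnn]; exact hidx _ (hno x hx)
    refine ⟨Classical.choose h, ?_, ?_⟩
    · simp only [ix]; rw [dif_pos h]
    · rw [← hnn]; exact Classical.choose_spec h
  have hl : ∀ x, x ≠ 0 → ∃ i : Fin k, l x = ((i : ℕ), decide (0 < f x i)) ∧ |f x i| = ‖f x‖ ∧
      l (-x) = ((i : ℕ), decide (0 < - f x i)) := by
    intro x hx
    obtain ⟨i, hi, hi2⟩ := hix x hx
    refine ⟨i, ?_, hi2, ?_⟩
    · simp only [l, ← hi]
      congr 2
      apply propext
      constructor
      · rintro ⟨j, hj, hj2⟩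
        rw [← Fin.ext hj]; exact hj2
      · intro h; exact ⟨i, rfl, h⟩
    · simp only [l, hodd, Pi.neg_apply, abs_neg, ← hi]
      congr 2
      apply propext
      constructor
      · rintro ⟨j, hj, hj2⟩
        rw [← Fin.ext hj]; exact hj2
      · intro h; exact ⟨i, rfl, h⟩
  let e : ℕ → EuclideanSpace ℝ (Fin d) := fun n =>
    if h : n < d then EuclideanSpace.single ⟨n, h⟩ 1 else 0
  have he : ∀ i < d, ∀ j < d, ⟪e i, e j⟫ = if i = j then (1:ℝ) else 0 := by
    intro i hi j hj
    simp only [e, dif_pos hi, dif_pos hj]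
    by_cases h : i = j
    · subst h; simp
    · rw [EuclideanSpace.inner_single_left]; simp [h]
  obtain ⟨h, s, h0, h1, h2, h3⟩ := exists_sys e d he N
  refine tucker l hkd h s h0 h1 h2 ?_
  intro n hn
  refine sup_mono ?_ (h3 n hn)
  rintro L ⟨hL, ⟨u, hu, hx⟩, hr⟩
  have hLK : ∀ x ∈ L, x ∈ K := by
    intro x hxm
    obtain ⟨h4, h5⟩ := hx x hxm
    refine ⟨by simpa using h5, ?_⟩
    have h6 := real_inner_le_norm u x
    rw [h4] at h6
    have h7 : 1 ≤ d * ‖x‖ := h6.trans (by gcongr)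
    change (d:ℝ)⁻¹ ≤ ‖x‖
    rw [inv_le_iff_one_le_mul₀ hd]
    linarith
  refine ⟨hL, ?_⟩
  intro x hxm
  have hx0 : x ≠ 0 := hK0 (hLK x hxm)
  obtain ⟨i, hi1, hi2, hi3⟩ := hl x hx0
  have hpos : 0 < |f x i| := by rw [hi2]; exact norm_pos_iff.2 (hno x hx0)
  refine ⟨by rw [hi1]; exact i.2, ?_, ?_⟩
  · rw [hi1, hi3, flip]
    congr 1
    rcases lt_or_gt_of_ne (abs_pos.1 hpos) with hlt | hgt
    · simp [hlt, hlt.le]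
    · simp [hgt, hgt.le]
  · intro y hym heq
    have hy0 : y ≠ 0 := hK0 (hLK y hym)
    obtain ⟨j, hj1, hj2, hj3⟩ := hl y hy0
    rw [hj1, hi1, flip, Prod.mk.injEq] at heq
    obtain ⟨hij, hb⟩ := heq
    obtain rfl := Fin.ext hij
    have hd1 := huc x (hLK x hxm) y (hLK y hym) ((hr x hxm y hym).trans_lt hN)
    have hd2 : |f x j - f y j| < c := by
      refine lt_of_le_of_lt ?_ hd1
      rw [dist_eq_norm]
      exact norm_le_pi_norm (f x - f y) j
    have c1 : c ≤ |f x j| := by rw [hi2]; exact hcK x (hLK x hxm)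
    have c2 : c ≤ |f y j| := by rw [hj2]; exact hcK y (hLK y hym)
    rw [abs_lt] at hd2
    by_cases hxp : 0 < f x j
    · have : ¬ 0 < f y j := by simpa [hxp] using hb
      rw [abs_of_pos hxp] at c1
      linarith
    · have : 0 < f y j := by simpa [hxp] using hb
      rw [abs_of_pos this] at c2
      linarith

lemma exists_fin {E ι : Type*} [AddCommGroup E] [Module ℝ E] (A : ι → Set E) (G : Finset ι)
    (p : E) (hp : p ∈ convexHull ℝ (⋃ i ∈ G, A i)) :
    ∃ t : ι → Finset E, (∀ i, (t i : Set E) ⊆ A i) ∧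
      p ∈ convexHull ℝ (⋃ i ∈ G, (t i : Set E)) := by
  classical
  rw [convexHull_eq_union_convexHull_finite_subsets] at hp
  simp only [Set.mem_iUnion] at hp
  obtain ⟨t, ht, hpt⟩ := hp
  refine ⟨fun i => t.filter (fun x => x ∈ A i), ?_, ?_⟩
  · intro i x hx
    simp at hx
    exact hx.2
  · refine convexHull_mono ?_ hpt
    intro x hx
    have := ht hx
    simp only [Set.mem_iUnion] at this ⊢
    obtain ⟨i, hi, hxi⟩ := this
    exact ⟨i, hi, by simpa using ⟨hx, hxi⟩⟩

lemma exists_B {E F ι : Type*} [AddCommGroup E] [Module ℝ E] [AddCommGroup F] [Module ℝ F]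
    [Fintype ι] [DecidableEq ι] (A : ι → Set E) (hne : ∀ i, (A i).Nonempty) (φ : ι → F)
    (hφ : ∀ G₁ G₂ : Finset ι, Disjoint G₁ G₂ →
      convexHull ℝ (⋃ i ∈ G₁, A i) ∩ convexHull ℝ (⋃ i ∈ G₂, A i) = ∅ →
      convexHull ℝ (φ '' (G₁ : Set ι)) ∩ convexHull ℝ (φ '' (G₂ : Set ι)) = ∅) :
    ∃ B : ι → Finset E, (∀ i, (B i).Nonempty) ∧ (∀ i, (B i : Set E) ⊆ A i) ∧
      ∀ G₁ G₂ : Finset ι, Disjoint G₁ G₂ →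
      (convexHull ℝ (φ '' (G₁ : Set ι)) ∩ convexHull ℝ (φ '' (G₂ : Set ι))).Nonempty →
      (convexHull ℝ (⋃ i ∈ G₁, (B i : Set E)) ∩
        convexHull ℝ (⋃ i ∈ G₂, (B i : Set E))).Nonempty := by
  classical
  have key : ∀ G : Finset ι × Finset ι, ∃ t : ι → Finset E, (∀ i, (t i : Set E) ⊆ A i) ∧
      (Disjoint G.1 G.2 →
      (convexHull ℝ (φ '' (G.1 : Set ι)) ∩ convexHull ℝ (φ '' (G.2 : Set ι))).Nonempty →
      (convexHull ℝ (⋃ i ∈ G.1, (t i : Set E)) ∩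
        convexHull ℝ (⋃ i ∈ G.2, (t i : Set E))).Nonempty) := by
    rintro ⟨G₁, G₂⟩
    by_cases h : Disjoint G₁ G₂ ∧
      (convexHull ℝ (φ '' (G₁ : Set ι)) ∩ convexHull ℝ (φ '' (G₂ : Set ι))).Nonempty
    · have h1 : (convexHull ℝ (⋃ i ∈ G₁, A i) ∩ convexHull ℝ (⋃ i ∈ G₂, A i)).Nonempty := by
        by_contra hcon
        rw [Set.not_nonempty_iff_eq_empty] at hcon
        have := hφ G₁ G₂ h.1 hcon
        rw [this] at h
        exact Set.not_nonempty_empty h.2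
      obtain ⟨p, hp1, hp2⟩ := h1
      obtain ⟨t1, ht1, hpt1⟩ := exists_fin A G₁ p hp1
      obtain ⟨t2, ht2, hpt2⟩ := exists_fin A G₂ p hp2
      refine ⟨fun i => t1 i ∪ t2 i, ?_, fun _ _ => ⟨p, ?_, ?_⟩⟩
      · intro i
        rw [Finset.coe_union]
        exact Set.union_subset (ht1 i) (ht2 i)
      · refine convexHull_mono ?_ hpt1
        exact Set.iUnion₂_mono (fun i _ => by simp)
      · refine convexHull_mono ?_ hpt2
        exact Set.iUnion₂_mono (fun i _ => by simp)
    · refine ⟨fun _ => ∅, by simp, fun h1 h2 => absurd ⟨h1, h2⟩ h⟩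
  choose t ht1 ht2 using key
  choose a ha using hne
  refine ⟨fun i => insert (a i) (Finset.univ.biUnion (fun G => t G i)), ?_, ?_, ?_⟩
  · intro i; exact Finset.insert_nonempty _ _
  · intro i x hx
    simp only [Finset.coe_insert, Finset.coe_biUnion, Set.mem_insert_iff, Set.mem_iUnion] at hx
    rcases hx with rfl | ⟨G, -, hx⟩
    · exact ha i
    · exact ht1 G i hx
  · intro G₁ G₂ hd hn
    obtain ⟨p, hp1, hp2⟩ := ht2 (G₁, G₂) hd hn
    have hsub : ∀ i, (t (G₁, G₂) i : Set E) ⊆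
        (insert (a i) (Finset.univ.biUnion (fun G => t G i)) : Finset E) := by
      intro i
      rw [Finset.coe_subset]
      exact (Finset.subset_biUnion_of_mem (fun G => t G i) (Finset.mem_univ (G₁, G₂))).trans
        (Finset.subset_insert _ _)
    exact ⟨p, convexHull_mono (Set.iUnion₂_mono (fun i _ => hsub i)) hp1,
      convexHull_mono (Set.iUnion₂_mono (fun i _ => hsub i)) hp2⟩

end
end GPW

/-- **Goodman–Pollack–Wenger.** Let `(A i)` be a finite family of
nonempty convex sets in `ℝ^d`, `0 ≤ k < d`.  If there is `φ : ι → ℝ^k` such that for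
all disjoint subfamilies `G₁, G₂`, disjointness of `conv G₁` and `conv G₂` implies
disjointness of `conv φ(G₁)` and `conv φ(G₂)`, then the family has a hyperplane
transversal. -/
theorem goodman_pollack_wenger
    {d k : ℕ} (hkd : k < d) {ι : Type*} [Fintype ι] [DecidableEq ι]
    (A : ι → Set (EuclideanSpace ℝ (Fin d)))
    (hconv : ∀ i, Convex ℝ (A i)) (hne : ∀ i, (A i).Nonempty)
    (φ : ι → EuclideanSpace ℝ (Fin k))
    (hφ : ∀ G₁ G₂ : Finset ι, Disjoint G₁ G₂ →
      convexHull ℝ (⋃ i ∈ G₁, A i) ∩ convexHull ℝ (⋃ i ∈ G₂, A i) = ∅ →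
      convexHull ℝ (φ '' (G₁ : Set ι)) ∩ convexHull ℝ (φ '' (G₂ : Set ι)) = ∅) :
    ∃ (w : EuclideanSpace ℝ (Fin d)) (a : ℝ), w ≠ 0 ∧
      ∀ i, (A i ∩ {x | ⟪x, w⟫ = a}).Nonempty := by
  classical
  obtain ⟨B, hB, hBA, hBφ⟩ := GPW.exists_B A hne φ hφ
  rcases isEmpty_or_nonempty ι with hι | hι
  · refine ⟨EuclideanSpace.single ⟨0, by omega⟩ 1, 0, ?_, fun i => hι.elim i⟩
    simp
  by_contra hno
  push Not at hno
  let M : ι → EuclideanSpace ℝ (Fin d) → ℝ := fun i w => (B i).sup' (hB i) (fun x => ⟪x, w⟫)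
  have hMc : ∀ i, Continuous (M i) := by
    intro i
    exact Continuous.finset_sup'_apply (hB i) (fun x _ => by fun_prop)
  have hMle : ∀ i w, ∀ x ∈ B i, ⟪x, w⟫ ≤ M i w := fun i w x hx =>
    Finset.le_sup' (fun x => ⟪x, w⟫) hx
  have hMex : ∀ i w, ∃ x ∈ B i, M i w = ⟪x, w⟫ := fun i w =>
    Finset.exists_mem_eq_sup' (hB i) _
  let a : EuclideanSpace ℝ (Fin d) → ℝ := fun w =>
    Finset.univ.inf' Finset.univ_nonempty (fun i => M i w)
  have hac : Continuous a :=
    Continuous.finset_inf'_apply Finset.univ_nonempty (fun i _ => hMc i)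
  have hale : ∀ i w, a w ≤ M i w := fun i w =>
    Finset.inf'_le (fun i => M i w) (Finset.mem_univ i)
  have haex : ∀ w, ∃ i, a w = M i w := fun w => by
    obtain ⟨i, -, hi⟩ := Finset.exists_mem_eq_inf' (s := (Finset.univ : Finset ι))
      Finset.univ_nonempty (fun i => M i w)
    exact ⟨i, hi⟩
  -- no transversal: `a w < - a (-w)`
  have hsep : ∀ w, w ≠ 0 → a w < - a (-w) := by
    intro w hw
    by_contra hle
    push Not at hle
    obtain ⟨i, hi⟩ := hno w (a w) hw
    obtain ⟨x, hx, hx2⟩ := hMex i w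
    obtain ⟨y, hy, hy2⟩ := hMex i (-w)
    have h1 : a w ≤ ⟪x, w⟫ := hx2 ▸ hale i w
    have h2 : ⟪y, w⟫ ≤ a w := by
      have := hale i (-w)
      rw [hy2, inner_neg_right] at this
      linarith
    have hc : Convex ℝ ((innerSL ℝ w) '' A i) :=
      (hconv i).linear_image (innerSL ℝ w : _ →L[ℝ] ℝ).toLinearMap
    have hmem : a w ∈ (innerSL ℝ w) '' A i := by
      refine hc.ordConnected.out ⟨y, hBA i hy, rfl⟩ ⟨x, hBA i hx, rfl⟩ ⟨?_, ?_⟩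
      · rw [innerSL_apply_apply, real_inner_comm]; exact h2
      · rw [innerSL_apply_apply, real_inner_comm]; exact h1
    obtain ⟨z, hz, hz2⟩ := hmem
    have : z ∈ A i ∩ {x | ⟪x, w⟫ = a w} := ⟨hz, by
      rw [innerSL_apply_apply, real_inner_comm] at hz2; exact hz2⟩
    rw [hi] at this
    exact this
  let c : EuclideanSpace ℝ (Fin d) → ℝ := fun w => (a w - a (-w)) / 2
  have hcodd : ∀ w, c (-w) = - c w := by
    intro w; simp only [c, neg_neg]; ring
  have hcc : Continuous c := by
    have := hac.comp continuous_neg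
    exact (hac.sub this).div_const 2
  let lam : ι → EuclideanSpace ℝ (Fin d) → ℝ := fun i w => max 0 (c w - M i w)
  have hlc : ∀ i, Continuous (lam i) := fun i => continuous_const.max (hcc.sub (hMc i))
  have hl0 : ∀ i w, 0 ≤ lam i w := fun i w => le_max_left _ _
  let Lam : EuclideanSpace ℝ (Fin d) → ℝ := fun w => ∑ i, lam i w
  have hLc : Continuous Lam := continuous_finsetSum _ (fun i _ => hlc i)
  have hLpos : ∀ w, w ≠ 0 → 0 < Lam w := by
    intro w hw
    obtain ⟨i, hi⟩ := haex w
    have h1 := hsep w hw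
    refine Finset.sum_pos' (fun i _ => hl0 i w) ⟨i, Finset.mem_univ _, ?_⟩
    refine lt_max_of_lt_right ?_
    simp only [c]
    linarith
  let g : EuclideanSpace ℝ (Fin d) → EuclideanSpace ℝ (Fin k) := fun w =>
    ∑ i, ((Lam w)⁻¹ * lam i w) • φ i
  have hgc : ContinuousOn g {0}ᶜ := by
    refine continuousOn_finsetSum _ (fun i _ => ?_)
    have h1 : ContinuousOn (fun w => (Lam w)⁻¹ * lam i w) {0}ᶜ :=
      (hLc.continuousOn.inv₀ (fun w hw => (hLpos w hw).ne')).mul (hlc i).continuousOn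
    have h2 : ContinuousOn (fun _ : EuclideanSpace ℝ (Fin d) => φ i) {0}ᶜ := continuousOn_const
    exact h1.smul h2
  have hgmem : ∀ w, w ≠ 0 →
      g w ∈ convexHull ℝ (φ '' ((Finset.univ.filter (fun i => 0 < lam i w) : Finset ι) : Set ι)) := by
    intro w hw
    have hLw := hLpos w hw
    have e : g w = ∑ i ∈ Finset.univ.filter (fun i => 0 < lam i w),
        ((Lam w)⁻¹ * lam i w) • φ i := by
      symm
      apply Finset.sum_subset (Finset.subset_univ _)
      intro i _ hi
      have : lam i w = 0 := le_antisymm (by simpa using hi) (hl0 i w)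
      simp [this]
    rw [e]
    refine (convex_convexHull ℝ _).sum_mem ?_ ?_ ?_
    · intro i _
      exact mul_nonneg (inv_nonneg.2 hLw.le) (hl0 i w)
    · rw [← Finset.mul_sum]
      have : ∑ i ∈ Finset.univ.filter (fun i => 0 < lam i w), lam i w = Lam w := by
        apply Finset.sum_subset (Finset.subset_univ _)
        intro i _ hi
        exact le_antisymm (by simpa using hi) (hl0 i w)
      rw [this, inv_mul_cancel₀ hLw.ne']
    · intro i hi
      exact subset_convexHull ℝ _ ⟨i, hi, rfl⟩
  have hlt : ∀ w i, 0 < lam i w → ∀ x ∈ B i, ⟪x, w⟫ < c w := by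
    intro w i hi x hx
    have h1 := hMle i w x hx
    rcases lt_max_iff.1 hi with h | h
    · exact absurd h (lt_irrefl _)
    · linarith
  have hhull : ∀ w, ∀ p ∈ convexHull ℝ
      (⋃ i ∈ Finset.univ.filter (fun i => 0 < lam i w), (B i : Set (EuclideanSpace ℝ (Fin d)))),
      ⟪p, w⟫ < c w := by
    intro w p hp
    have hsub : convexHull ℝ
      (⋃ i ∈ Finset.univ.filter (fun i => 0 < lam i w), (B i : Set (EuclideanSpace ℝ (Fin d))))
      ⊆ {x | ⟪x, w⟫ < c w} := by
      apply convexHull_min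
      · intro x hx
        simp only [Set.mem_iUnion] at hx
        obtain ⟨i, hi, hx⟩ := hx
        exact hlt w i (by simpa using hi) x hx
      · exact convex_halfSpace_lt (f := fun x : EuclideanSpace ℝ (Fin d) => ⟪x, w⟫)
          ⟨fun x y => inner_add_left _ _ _, fun c x => by simp [inner_smul_left]⟩ _
    exact hsub hp
  obtain ⟨w, hw, hw2⟩ := GPW.borsuk_ulam hkd (fun w j => g w j - g (-w) j)
    (by
      have hneg : ContinuousOn (fun w => g (-w)) {0}ᶜ :=
        hgc.comp continuous_neg.continuousOn (fun w hw => by simpa using hw)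
      rw [continuousOn_pi]
      intro j
      exact ((EuclideanSpace.proj j : EuclideanSpace ℝ (Fin k) →L[ℝ] ℝ).continuous.comp_continuousOn hgc).sub
        ((EuclideanSpace.proj j : EuclideanSpace ℝ (Fin k) →L[ℝ] ℝ).continuous.comp_continuousOn hneg))
    (by intro x; funext j; simp)
  have hg : g w = g (-w) := by
    ext j
    have := congrFun hw2 j
    simpa [sub_eq_zero] using this
  have hnw : -w ≠ 0 := by simpa using hw
  have hdis : Disjoint (Finset.univ.filter (fun i => 0 < lam i w))
      (Finset.univ.filter (fun i => 0 < lam i (-w))) := by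
    rw [Finset.disjoint_left]
    intro i hi hi2
    obtain ⟨x, hx⟩ := hB i
    have h1 := hlt w i (by simpa using hi) x hx
    have h2 := hlt (-w) i (by simpa using hi2) x hx
    rw [hcodd, inner_neg_right] at h2
    linarith
  obtain ⟨p, hp1, hp2⟩ := hBφ _ _ hdis ⟨g w, hgmem w hw, hg ▸ hgmem (-w) hnw⟩
  have h1 := hhull w p hp1
  have h2 := hhull (-w) p hp2
  rw [hcodd, inner_neg_right] at h2
  linarith
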